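/- Let $P = \{p_i\}$ be a sequence of natural numbers $\ge 2$ with $\sup_i p_i < \infty$, $m_n = \prod_{i=1}^n p_i$, and let the partial sums $S_{m_n}(x)$ of a Price series $\sum_k b_k \psi_k(x)$ converge almost everywhere on $[0,1]$ to a function $f$. Suppose there exists a sequence $\lambda_m \uparrow \infty$ with $\lim_{m \to \infty} \lambda_m\, \mu\{x \in [0,1] : S^*(x) > \lambda_m\} = 0$, where $S^*(x) = \sup_n |S_{m_n}(x)|$. Then for every $k \in \mathbb Z_+$, $b_k = \lim_{m \to \infty} \int_0^1 \left[ f(x)\, \overline{\psi_k(x)} \right]_{\lambda_m} dx$. -/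

import Mathlib

open MeasureTheory Filter Topology

noncomputable section

/-- `mseq p k = ∏_{i<k} p i`, i.e. `m_k = p_1 ⋯ p_k` (Lean indexes `p` from `0`). -/
def mseq (p : ℕ → ℕ) (k : ℕ) : ℕ := ∏ i ∈ Finset.range k, p i

/-- `pdigit p x j` is the `(j+1)`-st digit `x_{j+1}` of the `P`-adic expansion
`x = ∑_t x_t/m_t`, `0 ≤ x_t ≤ p_t - 1` (for `P`-rational points this floor-based digit
extraction yields exactly the finite expansion, as chosen in the paper). -/
def pdigit (p : ℕ → ℕ) (x : ℝ) (j : ℕ) : ℕ :=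
  (⌊x * (mseq p (j + 1) : ℝ)⌋ % (p j : ℤ)).toNat

/-- `e^{2πit}`. -/
def eTwoPi (t : ℝ) : ℂ := Complex.exp (2 * (Real.pi : ℂ) * Complex.I * (t : ℂ))

/-- The Price function `ψ_k(x) = exp(2πi ∑_j α_j x_j / p_j)`, where
`k = ∑_j α_j m_{j-1}` with digits `0 ≤ α_j ≤ p_j - 1` (so `α_{j+1} = (k / m_j) mod p_{j+1}`
in Lean's `0`-based indexing; digits with index `> k` vanish, so the cut-off below is
harmless). -/
def price (p : ℕ → ℕ) (k : ℕ) (x : ℝ) : ℂ :=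
  eTwoPi (∑ j ∈ Finset.range (k + 1),
    (((k / mseq p j) % p j : ℕ) : ℝ) * (pdigit p x j : ℝ) / (p j : ℝ))

/-- The rank of the generalized Haar function `χ_n`, i.e. the unique `k` with
`m_k ≤ n < m_{k+1}` (and `0` for `n = 0`). -/
def hrank (p : ℕ → ℕ) (n : ℕ) : ℕ := Nat.findGreatest (fun k => mseq p k ≤ n) n

/-- The generalized Haar function `χ_n`: `χ_0 ≡ 1`, and for
`n = m_k + r(p_{k+1} - 1) + s - 1` with `0 ≤ r ≤ m_k - 1`, `1 ≤ s ≤ p_{k+1} - 1`,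
`χ_n(x) = √(m_k) · e^{2πi x_{k+1} s / p_{k+1}}` for `x ∈ [r/m_k, (r+1)/m_k)` and `0`
otherwise. -/
def ghaar (p : ℕ → ℕ) (n : ℕ) (x : ℝ) : ℂ :=
  if n = 0 then 1
  else
    let k := hrank p n
    let r := (n - mseq p k) / (p k - 1)
    let s := (n - mseq p k) % (p k - 1) + 1
    if (r : ℝ) / (mseq p k : ℝ) ≤ x ∧ x < ((r : ℝ) + 1) / (mseq p k : ℝ) then
      (Real.sqrt (mseq p k) : ℂ) * eTwoPi ((pdigit p x k : ℝ) * (s : ℝ) / (p k : ℝ))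
    else 0

/-- The multiple generalized Haar function `χ^𝒫_n(x) = χ¹_{n₁}(x₁) ⋯ χᵈ_{n_d}(x_d)`. -/
def ghaarD {d : ℕ} (p : Fin d → ℕ → ℕ) (n : Fin d → ℕ) (x : Fin d → ℝ) : ℂ :=
  ∏ j, ghaar (p j) (n j) (x j)

/-- The multiple Price function `ψ^𝒫_n(x) = ψ¹_{n₁}(x₁) ⋯ ψᵈ_{n_d}(x_d)`. -/
def priceD {d : ℕ} (p : Fin d → ℕ → ℕ) (n : Fin d → ℕ) (x : Fin d → ℝ) : ℂ :=
  ∏ j, price (p j) (n j) (x j)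

/-- The `𝒫`-adic partial sum `∑_{n̄ < Ñ} a_{n̄} χ^𝒫_{n̄}(x)`, `Ñ = (N,…,N)`, where
`n̄ < Ñ` means `n_j < mʲ_N` for all `j`. -/
def ghaarSum {d : ℕ} (p : Fin d → ℕ → ℕ) (a : (Fin d → ℕ) → ℂ) (N : ℕ)
    (x : Fin d → ℝ) : ℂ :=
  ∑ n ∈ Fintype.piFinset (fun j => Finset.range (mseq (p j) N)), a n * ghaarD p n x

/-- The `𝒫`-adic partial sum `∑_{n̄ < Ñ} b_{n̄} ψ^𝒫_{n̄}(x)`. -/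
def priceSum {d : ℕ} (p : Fin d → ℕ → ℕ) (b : (Fin d → ℕ) → ℂ) (N : ℕ)
    (x : Fin d → ℝ) : ℂ :=
  ∑ n ∈ Fintype.piFinset (fun j => Finset.range (mseq (p j) N)), b n * priceD p n x

/-- Truncation of `f` at the constant level `lam`: `[f(x)]_lam`. -/
def trunc {α : Type*} (f : α → ℂ) (lam : ℝ) (x : α) : ℂ :=
  if ‖f x‖ ≤ lam then f x else 0

section Cells

/-- `x` and `y` lie in the same `P`-adic cell `[r/m_n, (r+1)/m_n)` of rank `n`. -/
def SameCell (p : ℕ → ℕ) (n : ℕ) (x y : ℝ) : Prop :=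
  ⌊x * (mseq p n : ℝ)⌋ = ⌊y * (mseq p n : ℝ)⌋

/-- `g` is constant on the `P`-adic cells of rank `n`. -/
def CellConst {α : Type*} (p : ℕ → ℕ) (n : ℕ) (g : ℝ → α) : Prop :=
  ∀ x y, SameCell p n x y → g x = g y

variable {p : ℕ → ℕ}

lemma mseq_succ (p : ℕ → ℕ) (n : ℕ) : mseq p (n + 1) = mseq p n * p n :=
  Finset.prod_range_succ _ _

lemma mseq_zero (p : ℕ → ℕ) : mseq p 0 = 1 := Finset.prod_range_zero _

lemma two_pow_le_mseq (hp : ∀ i, 2 ≤ p i) (n : ℕ) : 2 ^ n ≤ mseq p n := by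
  induction n with
  | zero => simp [mseq_zero]
  | succ n ih =>
    rw [mseq_succ, pow_succ]
    exact Nat.mul_le_mul ih (hp n)

lemma mseq_pos (hp : ∀ i, 2 ≤ p i) (n : ℕ) : 0 < mseq p n :=
  lt_of_lt_of_le (by positivity) (two_pow_le_mseq hp n)

lemma lt_mseq (hp : ∀ i, 2 ≤ p i) (n : ℕ) : n < mseq p n :=
  n.lt_two_pow_self.trans_le (two_pow_le_mseq hp n)

lemma mseq_dvd (p : ℕ → ℕ) {i n : ℕ} (h : i ≤ n) : mseq p i ∣ mseq p n :=
  Finset.prod_dvd_prod_of_subset _ _ _ (Finset.range_mono h)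

lemma mseq_mono (hp : ∀ i, 2 ≤ p i) {i n : ℕ} (h : i ≤ n) : mseq p i ≤ mseq p n :=
  Nat.le_of_dvd (mseq_pos hp n) (mseq_dvd p h)

lemma SameCell.symm {n : ℕ} {x y : ℝ} (h : SameCell p n x y) : SameCell p n y x := Eq.symm h

lemma SameCell.trans {n : ℕ} {x y z : ℝ} (h : SameCell p n x y) (h' : SameCell p n y z) :
    SameCell p n x z := Eq.trans h h'

lemma floor_mul_mseq_succ (hp : ∀ i, 2 ≤ p i) (n : ℕ) (x : ℝ) :
    ⌊x * (mseq p n : ℝ)⌋ = ⌊x * (mseq p (n + 1) : ℝ)⌋ / (p n : ℤ) := by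
  have hc0 : p n ≠ 0 := by have := hp n; omega
  rw [mseq_succ, ← Int.mul_natCast_floor_div_cancel hc0]
  push_cast
  rw [mul_assoc]

lemma SameCell.mono (hp : ∀ i, 2 ≤ p i) {i n : ℕ} (h : i ≤ n) {x y : ℝ}
    (hxy : SameCell p n x y) : SameCell p i x y := by
  obtain ⟨c, hc⟩ := mseq_dvd p h
  have hn := mseq_pos hp n
  have hc0 : c ≠ 0 := by rintro rfl; simp_all
  unfold SameCell at *
  rw [← Int.mul_natCast_floor_div_cancel hc0, ← Int.mul_natCast_floor_div_cancel hc0 (y * _)]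
  rw [hc] at hxy
  push_cast at hxy
  rw [mul_assoc, mul_assoc, hxy]

lemma CellConst.mono {α : Type*} (hp : ∀ i, 2 ≤ p i) {i n : ℕ} (h : i ≤ n) {g : ℝ → α}
    (hg : CellConst p i g) : CellConst p n g :=
  fun x y hxy => hg x y (hxy.mono hp h)

lemma SameCell.mem_Ico {n : ℕ} (hp : ∀ i, 2 ≤ p i) {x y : ℝ} (h : SameCell p n x y)
    (hx : x ∈ Set.Ico (0 : ℝ) 1) : y ∈ Set.Ico (0 : ℝ) 1 := by
  have h0 := h.mono hp (Nat.zero_le n)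
  simp only [SameCell, mseq_zero, Nat.cast_one, mul_one] at h0
  rw [← Int.floor_eq_zero_iff] at hx ⊢
  omega

lemma floor_grid (hp : ∀ i, 2 ≤ p i) (n : ℕ) (r : ℕ) :
    ⌊((r : ℝ) / (mseq p n : ℝ)) * (mseq p n : ℝ)⌋ = r := by
  have := mseq_pos hp n
  rw [div_mul_cancel₀ _ (by positivity)]
  simp

lemma sameCell_grid (hp : ∀ i, 2 ≤ p i) (n q d : ℕ) (hd : d < p n) :
    SameCell p n ((q * p n + d : ℕ) / (mseq p (n + 1) : ℝ)) (q / (mseq p n : ℝ)) := by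
  unfold SameCell
  rw [floor_grid hp, floor_mul_mseq_succ hp, floor_grid hp]
  norm_cast
  rw [mul_comm, Nat.mul_add_div (by omega), Nat.div_eq_of_lt hd, add_zero]

lemma pdigit_grid (hp : ∀ i, 2 ≤ p i) (n q d : ℕ) (hd : d < p n) :
    pdigit p ((q * p n + d : ℕ) / (mseq p (n + 1) : ℝ)) n = d := by
  unfold pdigit
  rw [floor_grid hp]
  norm_cast
  rw [mul_comm, Nat.mul_add_mod, Nat.mod_eq_of_lt hd]

lemma sum_range_mul {E : Type*} [AddCommMonoid E] (F : ℕ → E) (m k : ℕ) :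
    ∑ r ∈ Finset.range (m * k), F r
      = ∑ q ∈ Finset.range m, ∑ d ∈ Finset.range k, F (q * k + d) := by
  induction m with
  | zero => simp
  | succ m ih => rw [Nat.succ_mul, Finset.sum_range_add, ih, Finset.sum_range_succ]

lemma sameCell_floor (hp : ∀ i, 2 ≤ p i) (n : ℕ) {x : ℝ} (hx : 0 ≤ x) :
    SameCell p n x (⌊x * (mseq p n : ℝ)⌋.toNat / (mseq p n : ℝ)) := by
  unfold SameCell
  rw [floor_grid hp]
  have : 0 ≤ ⌊x * (mseq p n : ℝ)⌋ := Int.floor_nonneg.2 (by positivity)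
  omega

lemma CellConst.measurable {α : Type*} [MeasurableSpace α] (hp : ∀ i, 2 ≤ p i) {n : ℕ}
    {g : ℝ → α} (hg : CellConst p n g) : Measurable g := by
  have h : g = (fun z : ℤ => g (z / (mseq p n : ℝ))) ∘ fun x => ⌊x * (mseq p n : ℝ)⌋ := by
    funext x
    apply hg
    have := mseq_pos hp n
    unfold SameCell
    rw [div_mul_cancel₀ _ (by positivity)]
    simp
  rw [h]
  exact (measurable_of_countable _).comp (by fun_prop)

lemma measurableSet_of_cellConst (hp : ∀ i, 2 ≤ p i) {n : ℕ} {s : Set ℝ}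
    (hs : CellConst p n (fun x => x ∈ s)) : MeasurableSet s :=
  measurableSet_setOfPred.2 (hs.measurable hp)

variable {E : Type*} [NormedAddCommGroup E]

lemma CellConst.eqOn_sum_indicator (hp : ∀ i, 2 ≤ p i) {n : ℕ} {g : ℝ → E}
    (hg : CellConst p n g) :
    Set.EqOn g (fun x => ∑ r ∈ Finset.range (mseq p n),
      (Set.Ico ((r : ℝ) / mseq p n) ((r + 1 : ℝ) / mseq p n)).indicator
        (fun _ => g ((r : ℝ) / mseq p n)) x) (Set.Ico 0 1) := by
  intro x hx
  have hm : (0 : ℝ) < mseq p n := by exact_mod_cast mseq_pos hp n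
  have h0 : 0 ≤ ⌊x * (mseq p n : ℝ)⌋ :=
    Int.floor_nonneg.2 (mul_nonneg hx.1 hm.le)
  have h1 : ⌊x * (mseq p n : ℝ)⌋ < mseq p n := by
    rw [Int.floor_lt]
    push_cast
    nlinarith [hx.2]
  beta_reduce
  rw [Finset.sum_eq_single (⌊x * (mseq p n : ℝ)⌋.toNat)]
  · have hc : ((⌊x * (mseq p n : ℝ)⌋.toNat : ℕ) : ℝ) = (⌊x * (mseq p n : ℝ)⌋ : ℝ) := by
      exact_mod_cast Int.toNat_of_nonneg h0
    rw [Set.indicator_of_mem, ← hg _ _ (sameCell_floor hp n hx.1)]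
    rw [Set.mem_Ico, div_le_iff₀ hm, lt_div_iff₀ hm, hc]
    exact ⟨Int.floor_le _, Int.lt_floor_add_one _⟩
  · intro r _ hr
    rw [Set.indicator_of_notMem]
    rw [Set.mem_Ico, div_le_iff₀ hm, lt_div_iff₀ hm]
    rintro ⟨ha, hb⟩
    apply hr
    have : ⌊x * (mseq p n : ℝ)⌋ = (r : ℤ) := Int.floor_eq_iff.2
      ⟨by exact_mod_cast ha, by exact_mod_cast hb⟩
    omega
  · intro h
    exact absurd (Finset.mem_range.2 (by omega)) h

lemma integrable_cell_indicator (a b : ℝ) (c : E) :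
    Integrable ((Set.Ico a b).indicator fun _ => c) (volume.restrict (Set.Ico (0 : ℝ) 1)) :=
  (integrable_const c).indicator measurableSet_Ico

lemma CellConst.integrableOn (hp : ∀ i, 2 ≤ p i) {n : ℕ} {g : ℝ → E}
    (hg : CellConst p n g) : IntegrableOn g (Set.Ico (0 : ℝ) 1) := by
  refine IntegrableOn.congr_fun ?_ (hg.eqOn_sum_indicator hp).symm measurableSet_Ico
  exact integrable_finsetSum _ fun r _ => integrable_cell_indicator _ _ _

variable [NormedSpace ℝ E]

lemma CellConst.setIntegral [CompleteSpace E] (hp : ∀ i, 2 ≤ p i) {n : ℕ} {g : ℝ → E}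
    (hg : CellConst p n g) :
    ∫ x in Set.Ico (0 : ℝ) 1, g x
      = (mseq p n : ℝ)⁻¹ • ∑ r ∈ Finset.range (mseq p n), g ((r : ℝ) / mseq p n) := by
  have hm : (0 : ℝ) < mseq p n := by exact_mod_cast mseq_pos hp n
  rw [setIntegral_congr_fun measurableSet_Ico (hg.eqOn_sum_indicator hp),
    integral_finsetSum _ fun r _ => integrable_cell_indicator _ _ _, Finset.smul_sum]
  refine Finset.sum_congr rfl fun r hr => ?_
  have hr' : ((r : ℝ) + 1) ≤ mseq p n := by exact_mod_cast Finset.mem_range.1 hr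
  rw [setIntegral_indicator measurableSet_Ico, Set.inter_eq_self_of_subset_right,
    setIntegral_const]
  · congr 1
    rw [Real.volume_real_Ico_of_le (by gcongr; linarith)]
    field_simp
    ring
  · intro x hx
    refine ⟨le_trans (by positivity) hx.1, hx.2.trans_le ?_⟩
    rwa [div_le_one hm]

lemma CellConst.setIntegral_succ [CompleteSpace E] (hp : ∀ i, 2 ≤ p i) {n : ℕ} {g : ℝ → E}
    (hg : CellConst p (n + 1) g) :
    ∫ x in Set.Ico (0 : ℝ) 1, g x
      = (mseq p (n + 1) : ℝ)⁻¹ • ∑ q ∈ Finset.range (mseq p n), ∑ d ∈ Finset.range (p n),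
          g ((q * p n + d : ℕ) / (mseq p (n + 1) : ℝ)) := by
  rw [hg.setIntegral hp, ← sum_range_mul (fun r : ℕ => g ((r : ℝ) / (mseq p (n + 1) : ℝ))),
    ← mseq_succ]

/-- If every cell of rank `n` inside `V` contains a cell of rank `n + 1` inside `W`, then the
measure of `V` is at most `p_n` times that of `W`. -/
lemma measure_le_mul_of_cells (hp : ∀ i, 2 ≤ p i) {n : ℕ} {V W : Set ℝ}
    (hV : CellConst p n (fun x => x ∈ V)) (hW : CellConst p (n + 1) (fun x => x ∈ W))
    (hVW : ∀ x ∈ V, ∃ y ∈ W, SameCell p n x y) :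
    volume (V ∩ Set.Ico 0 1) ≤ p n * volume (W ∩ Set.Ico 0 1) := by
  have hmV := measurableSet_of_cellConst hp hV
  have hmW := measurableSet_of_cellConst hp hW
  have hm : (0 : ℝ) < mseq p n := by exact_mod_cast mseq_pos hp n
  have hpn : (0 : ℝ) < p n := by exact_mod_cast (by have := hp n; omega : 0 < p n)
  have cV : CellConst p n (V.indicator (1 : ℝ → ℝ)) := fun x y h => by
    classical
    simp only [Set.indicator_apply, (hV x y h : (x ∈ V) = (y ∈ V))]; rfl
  have cW : CellConst p (n + 1) (W.indicator (1 : ℝ → ℝ)) := fun x y h => by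
    classical
    simp only [Set.indicator_apply, (hW x y h : (x ∈ W) = (y ∈ W))]; rfl
  have iV := cV.setIntegral hp
  have iW := cW.setIntegral_succ hp
  rw [integral_indicator_one hmV, measureReal_restrict_apply hmV] at iV
  rw [integral_indicator_one hmW, measureReal_restrict_apply hmW] at iW
  have hreal : volume.real (V ∩ Set.Ico 0 1) ≤ p n * volume.real (W ∩ Set.Ico 0 1) := by
    rw [iV, iW, mseq_succ, smul_eq_mul, smul_eq_mul, Nat.cast_mul, mul_inv, ← mul_assoc,
      mul_comm (p n : ℝ), mul_assoc _ _ (p n : ℝ), inv_mul_cancel₀ hpn.ne', mul_one]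
    gcongr with q hq
    have nonneg : ∀ x, 0 ≤ W.indicator (1 : ℝ → ℝ) x :=
      Set.indicator_nonneg fun _ _ => zero_le_one
    by_cases hqV : (q : ℝ) / mseq p n ∈ V
    · obtain ⟨y, hyW, hy⟩ := hVW _ hqV
      rw [Set.indicator_of_mem hqV]
      have hfl : ⌊y * (mseq p n : ℝ)⌋ = q := by
        rw [← floor_grid hp n q]; exact hy.symm
      have hy0 : 0 ≤ y := by
        have : 0 ≤ ⌊y * (mseq p n : ℝ)⌋ := by omega
        rw [Int.floor_nonneg] at this
        exact nonneg_of_mul_nonneg_left this hm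
      rw [floor_mul_mseq_succ hp] at hfl
      have hs := sameCell_floor hp (n + 1) hy0
      have hN : 0 ≤ ⌊y * (mseq p (n + 1) : ℝ)⌋ := Int.floor_nonneg.2 (by positivity)
      generalize ⌊y * (mseq p (n + 1) : ℝ)⌋ = z at hfl hs hN
      lift z to ℕ using hN
      have hz : z / p n = q := by exact_mod_cast hfl
      have hd : z % p n < p n := Nat.mod_lt _ (by have := hp n; omega)
      have hzq : z = q * p n + z % p n := by rw [← hz, mul_comm, Nat.div_add_mod]
      simp only [Int.toNat_natCast] at hs
      rw [mseq_succ, hzq, ← mseq_succ] at hs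
      have := Finset.single_le_sum (f := fun d => W.indicator (1 : ℝ → ℝ)
        ((q * p n + d : ℕ) / (mseq p (n + 1) : ℝ))) (fun d _ => nonneg _)
        (Finset.mem_range.2 hd)
      rw [mseq_succ, Nat.cast_mul] at this
      refine le_trans (le_of_eq ?_) this
      rw [← Nat.cast_mul, ← mseq_succ, ← cW _ _ hs, Set.indicator_of_mem hyW]
      rfl
    · rw [Set.indicator_of_notMem hqV]
      exact Finset.sum_nonneg fun d _ => nonneg _
  have fV : volume (V ∩ Set.Ico (0 : ℝ) 1) ≠ ⊤ :=
    measure_ne_top_of_subset Set.inter_subset_right (by simp)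
  have fW : volume (W ∩ Set.Ico (0 : ℝ) 1) ≠ ⊤ :=
    measure_ne_top_of_subset Set.inter_subset_right (by simp)
  rw [← ENNReal.toReal_le_toReal fV (ENNReal.mul_ne_top (by simp) fW), ENNReal.toReal_mul,
    ENNReal.toReal_natCast]
  exact hreal

end Cells

section Price

variable {p : ℕ → ℕ}

lemma eTwoPi_zero : eTwoPi 0 = 1 := by simp [eTwoPi]

lemma eTwoPi_add (s t : ℝ) : eTwoPi (s + t) = eTwoPi s * eTwoPi t := by
  simp [eTwoPi, mul_add, Complex.exp_add]

lemma norm_eTwoPi (t : ℝ) : ‖eTwoPi t‖ = 1 := by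
  have : 2 * (Real.pi : ℂ) * Complex.I * (t : ℂ) = ((2 * Real.pi * t : ℝ) : ℂ) * Complex.I := by
    push_cast; ring
  rw [eTwoPi, this, Complex.norm_exp_ofReal_mul_I]

lemma conj_eTwoPi (t : ℝ) : (starRingEnd ℂ) (eTwoPi t) = eTwoPi (-t) := by
  rw [eTwoPi, eTwoPi, ← Complex.exp_conj]
  simp [map_ofNat]

lemma eTwoPi_nat_mul (n : ℕ) (t : ℝ) : eTwoPi (n * t) = eTwoPi t ^ n := by
  rw [eTwoPi, eTwoPi, ← Complex.exp_nat_mul]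
  congr 1
  push_cast
  ring

lemma eTwoPi_eq_one_iff (t : ℝ) : eTwoPi t = 1 ↔ ∃ z : ℤ, t = z := by
  rw [eTwoPi, Complex.exp_eq_one_iff]
  refine exists_congr fun z => ?_
  rw [mul_comm, mul_left_inj' Complex.two_pi_I_ne_zero]
  norm_cast

lemma sum_eTwoPi_eq_zero {k : ℕ} {a : ℤ} (ha : ¬ (k : ℤ) ∣ a) (hk : k ≠ 0) :
    ∑ d ∈ Finset.range k, eTwoPi (a * d / k) = 0 := by
  have hk' : (k : ℝ) ≠ 0 := by exact_mod_cast hk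
  have h1 : eTwoPi (a / k) ≠ 1 := by
    rw [Ne, eTwoPi_eq_one_iff]
    rintro ⟨z, hz⟩
    rw [div_eq_iff hk'] at hz
    exact ha ⟨z, by rw [mul_comm]; exact_mod_cast hz⟩
  have h2 : eTwoPi (a / k) ^ k = 1 := by
    rw [← eTwoPi_nat_mul, eTwoPi_eq_one_iff]
    exact ⟨a, by field_simp⟩
  calc ∑ d ∈ Finset.range k, eTwoPi (a * d / k)
      = ∑ d ∈ Finset.range k, eTwoPi (a / k) ^ d :=
        Finset.sum_congr rfl fun d _ => by rw [← eTwoPi_nat_mul]; congr 1; ring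
    _ = 0 := by rw [geom_sum_eq h1, h2, sub_self, zero_div]

lemma cellConst_pdigit (hp : ∀ i, 2 ≤ p i) {i n : ℕ} (h : i < n) :
    CellConst p n (fun x => pdigit p x i) := by
  refine CellConst.mono hp h fun x y hxy => ?_
  have : ⌊x * (mseq p (i + 1) : ℝ)⌋ = ⌊y * (mseq p (i + 1) : ℝ)⌋ := hxy
  simp only [pdigit, this]

/-- A function of rank `n` is orthogonal to every nontrivial character of the next digit. -/
lemma integral_cellConst_mul_eTwoPi (hp : ∀ i, 2 ≤ p i) {n : ℕ} {g : ℝ → ℂ}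
    (hg : CellConst p n g) {a : ℤ} (ha : ¬ (p n : ℤ) ∣ a) :
    ∫ x in Set.Ico (0 : ℝ) 1, g x * eTwoPi (a * pdigit p x n / p n) = 0 := by
  have hpn : p n ≠ 0 := by have := hp n; omega
  have hc : CellConst p (n + 1) (fun x => g x * eTwoPi (a * pdigit p x n / p n)) :=
    fun x y h => by
      simp only [hg x y (h.mono hp n.le_succ), cellConst_pdigit hp n.lt_succ_self x y h]
  rw [hc.setIntegral_succ hp]
  have : ∀ q ∈ Finset.range (mseq p n), ∑ d ∈ Finset.range (p n),
      g ((q * p n + d : ℕ) / (mseq p (n + 1) : ℝ)) *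
        eTwoPi (a * pdigit p ((q * p n + d : ℕ) / (mseq p (n + 1) : ℝ)) n / p n) = 0 := by
    intro q _
    calc _ = ∑ d ∈ Finset.range (p n), g (q / mseq p n) * eTwoPi (a * d / p n) := by
          refine Finset.sum_congr rfl fun d hd => ?_
          rw [pdigit_grid hp n q d (Finset.mem_range.1 hd),
            hg _ _ (sameCell_grid hp n q d (Finset.mem_range.1 hd))]
      _ = 0 := by rw [← Finset.mul_sum, sum_eTwoPi_eq_zero ha hpn, mul_zero]
  rw [Finset.sum_eq_zero this, smul_zero]

lemma price_eq (hp : ∀ i, 2 ≤ p i) {n k : ℕ} (hk : k < mseq p n) (x : ℝ) :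
    price p k x = eTwoPi (∑ j ∈ Finset.range n,
      (((k / mseq p j) % p j : ℕ) : ℝ) * (pdigit p x j : ℝ) / (p j : ℝ)) := by
  have key : ∀ {a b : ℕ}, a ≤ b → k < mseq p a →
      ∑ j ∈ Finset.range a, (((k / mseq p j) % p j : ℕ) : ℝ) * (pdigit p x j : ℝ) / (p j : ℝ)
      = ∑ j ∈ Finset.range b,
        (((k / mseq p j) % p j : ℕ) : ℝ) * (pdigit p x j : ℝ) / (p j : ℝ) := by
    intro a b hab ha
    refine Finset.sum_subset (Finset.range_mono hab) fun j _ hj => ?_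
    rw [Finset.mem_range, not_lt] at hj
    rw [Nat.div_eq_of_lt (ha.trans_le (mseq_mono hp hj))]
    simp
  rw [price]
  rcases le_total (k + 1) n with h | h
  · rw [key h (k.lt_succ_self.trans (lt_mseq hp _))]
  · rw [key h hk]

lemma norm_price (p : ℕ → ℕ) (k : ℕ) (x : ℝ) : ‖price p k x‖ = 1 := norm_eTwoPi _

lemma cellConst_price (hp : ∀ i, 2 ≤ p i) {n k : ℕ} (hk : k < mseq p n) :
    CellConst p n (price p k) := by
  intro x y hxy
  rw [price_eq hp hk, price_eq hp hk]
  congr 1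
  refine Finset.sum_congr rfl fun j hj => ?_
  simp only [cellConst_pdigit hp (Finset.mem_range.1 hj) x y hxy]

lemma price_split (hp : ∀ i, 2 ≤ p i) {n k : ℕ} (hk : k < mseq p (n + 1)) (x : ℝ) :
    price p k x = price p (k % mseq p n) x *
      eTwoPi ((k / mseq p n : ℕ) * pdigit p x n / p n) := by
  rw [price_eq hp hk, price_eq hp (Nat.mod_lt _ (mseq_pos hp n)), Finset.sum_range_succ,
    eTwoPi_add, Nat.mod_eq_of_lt (b := p n)]
  · congr 2
    refine Finset.sum_congr rfl fun j hj => ?_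
    obtain ⟨c, hc⟩ := mseq_dvd p (Nat.succ_le_of_lt (Finset.mem_range.1 hj))
    have : k % mseq p n / mseq p j % p j = k / mseq p j % p j := by
      rw [hc, mseq_succ, mul_assoc, Nat.mod_mul_right_div_self,
        Nat.mod_mod_of_dvd _ (Dvd.intro _ rfl)]
    rw [this]
  · rw [mseq_succ] at hk
    exact Nat.div_lt_of_lt_mul hk

lemma integral_price_mul_conj (hp : ∀ i, 2 ≤ p i) (n : ℕ) {j k : ℕ} (hj : j < mseq p n)
    (hk : k < mseq p n) :
    ∫ x in Set.Ico (0 : ℝ) 1, price p j x * (starRingEnd ℂ) (price p k x)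
      = if j = k then 1 else 0 := by
  split_ifs with hjk
  · subst hjk
    simp [Complex.mul_conj, Complex.normSq_eq_norm_sq, norm_price]
  induction n generalizing j k with
  | zero => rw [mseq_zero] at hj hk; omega
  | succ n ih =>
    have hm := mseq_pos hp n
    have hsplit : ∀ x, price p j x * (starRingEnd ℂ) (price p k x)
        = (price p (j % mseq p n) x * (starRingEnd ℂ) (price p (k % mseq p n) x)) *
          eTwoPi ((((j / mseq p n : ℕ) - (k / mseq p n : ℕ) : ℤ) : ℝ) * pdigit p x n / p n) := by
      intro x
      rw [price_split hp hj, price_split hp hk, map_mul, conj_eTwoPi, mul_mul_mul_comm,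
        ← eTwoPi_add]
      generalize j / mseq p n = u
      generalize k / mseq p n = v
      congr 2
      push_cast
      ring
    simp_rw [hsplit]
    by_cases hd : j / mseq p n = k / mseq p n
    · simp only [hd, sub_self, Int.cast_zero, zero_mul, zero_div, eTwoPi_zero, mul_one]
      refine ih (Nat.mod_lt _ hm) (Nat.mod_lt _ hm) fun h => hjk ?_
      rw [← Nat.div_add_mod j (mseq p n), ← Nat.div_add_mod k (mseq p n), hd, h]
    · refine integral_cellConst_mul_eTwoPi hp ?_ ?_
      · intro x y h
        simp only [cellConst_price hp (Nat.mod_lt _ hm) x y h]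
      · rw [mseq_succ] at hj hk
        have h1 := Nat.div_lt_of_lt_mul hj
        have h2 := Nat.div_lt_of_lt_mul hk
        generalize j / mseq p n = u at *
        generalize k / mseq p n = v at *
        intro h
        have := Int.eq_zero_of_abs_lt_dvd h (by rw [abs_lt]; omega)
        omega

lemma integral_cellConst_mul_price (hp : ∀ i, 2 ≤ p i) {n k : ℕ} {g : ℝ → ℂ}
    (hg : CellConst p n g) (h1 : mseq p n ≤ k) (h2 : k < mseq p (n + 1)) :
    ∫ x in Set.Ico (0 : ℝ) 1, g x * price p k x = 0 := by
  have hm := mseq_pos hp n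
  simp_rw [price_split hp h2, ← mul_assoc]
  have hk : k / mseq p n < p n := by
    rw [mseq_succ] at h2; exact Nat.div_lt_of_lt_mul h2
  have hk0 : 0 < k / mseq p n := Nat.div_pos h1 hm
  refine integral_cellConst_mul_eTwoPi (a := (k / mseq p n : ℕ)) hp ?_ ?_
  · intro x y h
    simp only [hg x y h, cellConst_price hp (Nat.mod_lt _ hm) x y h]
  · norm_cast
    exact Nat.not_dvd_of_pos_of_lt hk0 hk

/-- The partial sum `S_{m_n}` of the Price series with coefficients `b`. -/
def pricePartialSum (p : ℕ → ℕ) (b : ℕ → ℂ) (n : ℕ) (x : ℝ) : ℂ :=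
  ∑ k ∈ Finset.range (mseq p n), b k * price p k x

lemma cellConst_pricePartialSum (hp : ∀ i, 2 ≤ p i) (b : ℕ → ℂ) (n : ℕ) :
    CellConst p n (pricePartialSum p b n) := by
  intro x y h
  refine Finset.sum_congr rfl fun k hk => ?_
  rw [cellConst_price hp (Finset.mem_range.1 hk) x y h]

lemma norm_pricePartialSum_le (p : ℕ → ℕ) (b : ℕ → ℂ) (n : ℕ) (x : ℝ) :
    ‖pricePartialSum p b n x‖ ≤ ∑ k ∈ Finset.range (mseq p n), ‖b k‖ :=
  (norm_sum_le _ _).trans (by simp [norm_price])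

lemma integral_pricePartialSum_mul_conj (hp : ∀ i, 2 ≤ p i) (b : ℕ → ℂ) {n k : ℕ}
    (hk : k < mseq p n) :
    ∫ x in Set.Ico (0 : ℝ) 1, pricePartialSum p b n x * (starRingEnd ℂ) (price p k x) = b k := by
  have hint : ∀ j ∈ Finset.range (mseq p n), IntegrableOn
      (fun x => b j * (price p j x * (starRingEnd ℂ) (price p k x))) (Set.Ico (0 : ℝ) 1) := by
    intro j hj
    refine CellConst.integrableOn hp (n := n) fun x y h => ?_
    simp only [cellConst_price hp (Finset.mem_range.1 hj) x y h, cellConst_price hp hk x y h]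
  simp_rw [pricePartialSum, Finset.sum_mul, mul_assoc]
  rw [integral_finsetSum _ hint]
  simp_rw [integral_const_mul]
  rw [Finset.sum_congr rfl fun j hj => by
    rw [integral_price_mul_conj hp n (Finset.mem_range.1 hj) hk]]
  simp [hk]

lemma integral_cellConst_mul_pricePartialSum_sub (hp : ∀ i, 2 ≤ p i) (b : ℕ → ℂ) {n : ℕ}
    {g : ℝ → ℂ} (hg : CellConst p n g) :
    ∫ x in Set.Ico (0 : ℝ) 1, g x * (pricePartialSum p b (n + 1) x - pricePartialSum p b n x)
      = 0 := by
  have hle := mseq_mono hp n.le_succ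
  have hsub : ∀ x, g x * (pricePartialSum p b (n + 1) x - pricePartialSum p b n x)
      = ∑ k ∈ Finset.Ico (mseq p n) (mseq p (n + 1)), b k * (g x * price p k x) := by
    intro x
    rw [pricePartialSum, pricePartialSum, ← Finset.sum_Ico_eq_sub _ hle, Finset.mul_sum]
    exact Finset.sum_congr rfl fun k _ => by ring
  simp_rw [hsub]
  rw [integral_finsetSum]
  · refine Finset.sum_eq_zero fun k hk => ?_
    rw [Finset.mem_Ico] at hk
    rw [integral_const_mul, integral_cellConst_mul_price hp hg hk.1 hk.2, mul_zero]
  · intro k hk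
    rw [Finset.mem_Ico] at hk
    refine CellConst.integrableOn hp (n := n + 1) fun x y h => ?_
    simp only [hg x y (h.mono hp n.le_succ), cellConst_price hp hk.2 x y h]

end Price

section Stopping

variable {p : ℕ → ℕ} {b : ℕ → ℂ} {c : ℝ}

/-- No partial sum of rank `i + 1 ≤ n` exceeds `c` in norm on the rank-`i` cell of `x`. -/
def BoundedNear (p : ℕ → ℕ) (b : ℕ → ℂ) (c : ℝ) (n : ℕ) (x : ℝ) : Prop :=
  ∀ i < n, ∀ y, SameCell p i x y → ‖pricePartialSum p b (i + 1) y‖ ≤ c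

/-- The partial sums, stopped just before they may exceed `c` in norm. -/
def stoppedSum (p : ℕ → ℕ) (b : ℕ → ℂ) (c : ℝ) : ℕ → ℝ → ℂ
  | 0 => pricePartialSum p b 0
  | n + 1 => fun x => stoppedSum p b c n x + {x | BoundedNear p b c (n + 1) x}.indicator
      (fun x => pricePartialSum p b (n + 1) x - pricePartialSum p b n x) x

/-- The set where the partial sums get stopped at some time. -/
def stopSet (p : ℕ → ℕ) (b : ℕ → ℂ) (c : ℝ) : Set ℝ := {x | ∃ n, ¬ BoundedNear p b c n x}

lemma BoundedNear.mono {i n : ℕ} (h : i ≤ n) {x : ℝ} (hx : BoundedNear p b c n x) :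
    BoundedNear p b c i x :=
  fun j hj => hx j (hj.trans_le h)

lemma boundedNear_congr (hp : ∀ i, 2 ≤ p i) {n m : ℕ} (hm : n ≤ m + 1) {x y : ℝ}
    (h : SameCell p m x y) : BoundedNear p b c n x ↔ BoundedNear p b c n y := by
  refine forall₂_congr fun i hi => forall_congr' fun z => ?_
  have hi' := h.mono hp (i := i) (by omega)
  exact ⟨fun H hz => H (hi'.trans hz), fun H hz => H (hi'.symm.trans hz)⟩

lemma cellConst_boundedNear (hp : ∀ i, 2 ≤ p i) {n m : ℕ} (hm : n ≤ m + 1) :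
    CellConst p m (BoundedNear p b c n) :=
  fun _ _ h => propext (boundedNear_congr hp hm h)

lemma stoppedSum_succ_of_boundedNear {n : ℕ} {x : ℝ} (h : BoundedNear p b c (n + 1) x) :
    stoppedSum p b c (n + 1) x
      = stoppedSum p b c n x + (pricePartialSum p b (n + 1) x - pricePartialSum p b n x) := by
  simp only [stoppedSum]
  rw [Set.indicator_of_mem (show x ∈ {x | BoundedNear p b c (n + 1) x} from h)]

lemma stoppedSum_succ_of_not_boundedNear {n : ℕ} {x : ℝ}
    (h : ¬ BoundedNear p b c (n + 1) x) :
    stoppedSum p b c (n + 1) x = stoppedSum p b c n x := by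
  simp only [stoppedSum]
  rw [Set.indicator_of_notMem
    (show x ∉ {x | BoundedNear p b c (n + 1) x} from h), add_zero]

lemma stoppedSum_eq {n : ℕ} {x : ℝ} (h : BoundedNear p b c n x) :
    stoppedSum p b c n x = pricePartialSum p b n x := by
  induction n with
  | zero => rfl
  | succ n ih =>
    rw [stoppedSum_succ_of_boundedNear h, ih (h.mono n.le_succ), add_sub_cancel]

lemma stoppedSum_eq_of_le {N n : ℕ} (hn : N ≤ n) {x : ℝ} (h : ¬ BoundedNear p b c N x) :
    stoppedSum p b c n x = stoppedSum p b c N x := by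
  induction n, hn using Nat.le_induction with
  | base => rfl
  | succ n hn ih =>
    rw [stoppedSum_succ_of_not_boundedNear fun H => h (H.mono (by omega)), ih]

lemma norm_stoppedSum_le (h0 : ∀ x, ‖pricePartialSum p b 0 x‖ ≤ c) (n : ℕ) (x : ℝ) :
    ‖stoppedSum p b c n x‖ ≤ c := by
  induction n with
  | zero => exact h0 x
  | succ n ih =>
    by_cases h : BoundedNear p b c (n + 1) x
    · rw [stoppedSum_eq h]
      exact h n n.lt_succ_self x rfl
    · rwa [stoppedSum_succ_of_not_boundedNear h]

lemma cellConst_stoppedSum (hp : ∀ i, 2 ≤ p i) (n : ℕ) :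
    CellConst p n (stoppedSum p b c n) := by
  induction n with
  | zero => exact cellConst_pricePartialSum hp b 0
  | succ n ih =>
    intro x y h
    have h' := h.mono hp n.le_succ
    have hb := boundedNear_congr (b := b) (c := c) hp le_rfl h'
    by_cases hx : BoundedNear p b c (n + 1) x
    · rw [stoppedSum_succ_of_boundedNear hx, stoppedSum_succ_of_boundedNear (hb.1 hx), ih x y h',
        cellConst_pricePartialSum hp b _ x y h, cellConst_pricePartialSum hp b _ x y h']
    · rw [stoppedSum_succ_of_not_boundedNear hx,
        stoppedSum_succ_of_not_boundedNear (fun H => hx (hb.2 H)), ih x y h']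

lemma integral_stoppedSum_mul_conj (hp : ∀ i, 2 ≤ p i) {N n k : ℕ} (hk : k < mseq p N)
    (hN : ∀ x, BoundedNear p b c N x) (hn : N ≤ n) :
    ∫ x in Set.Ico (0 : ℝ) 1, stoppedSum p b c n x * (starRingEnd ℂ) (price p k x) = b k := by
  induction n, hn using Nat.le_induction with
  | base =>
    simp_rw [fun x => stoppedSum_eq (hN x)]
    exact integral_pricePartialSum_mul_conj hp b hk
  | succ n hn ih =>
    have hkn : k < mseq p n := hk.trans_le (mseq_mono hp hn)
    set g : ℝ → ℂ := {x | BoundedNear p b c (n + 1) x}.indicator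
      (fun x => (starRingEnd ℂ) (price p k x)) with hgdef
    have hg : CellConst p n g := by
      intro x y h
      have hb := boundedNear_congr (b := b) (c := c) hp le_rfl h
      classical
      simp only [hgdef, Set.indicator_apply, Set.mem_ofPred_eq, hb, cellConst_price hp hkn x y h]
    have hsplit : ∀ x, stoppedSum p b c (n + 1) x * (starRingEnd ℂ) (price p k x)
        = stoppedSum p b c n x * (starRingEnd ℂ) (price p k x)
          + g x * (pricePartialSum p b (n + 1) x - pricePartialSum p b n x) := by
      intro x
      by_cases h : BoundedNear p b c (n + 1) x
      · rw [stoppedSum_succ_of_boundedNear h, hgdef, Set.indicator_of_mem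
          (show x ∈ {x | BoundedNear p b c (n + 1) x} from h)]
        ring
      · rw [stoppedSum_succ_of_not_boundedNear h, hgdef, Set.indicator_of_notMem
          (show x ∉ {x | BoundedNear p b c (n + 1) x} from h)]
        ring
    simp_rw [hsplit]
    rw [integral_add, ih, integral_cellConst_mul_pricePartialSum_sub hp b hg, add_zero]
    · refine CellConst.integrableOn hp (n := n) fun x y h => ?_
      simp only [cellConst_stoppedSum hp n x y h, cellConst_price hp hkn x y h]
    · refine CellConst.integrableOn hp (n := n + 1) fun x y h => ?_
      have h' := h.mono hp n.le_succ
      simp only [hg x y h', cellConst_pricePartialSum hp b _ x y h,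
        cellConst_pricePartialSum hp b _ x y h']

lemma measurableSet_stopSet (hp : ∀ i, 2 ≤ p i) : MeasurableSet (stopSet p b c) := by
  have : stopSet p b c = ⋃ n, {x | ¬ BoundedNear p b c n x} := by
    ext x; simp [stopSet]
  rw [this]
  refine MeasurableSet.iUnion fun n => measurableSet_of_cellConst hp (n := n) fun x y h => ?_
  exact congrArg Not (cellConst_boundedNear hp n.le_succ x y h)

/-- The stopped set is controlled by the set where the maximal function exceeds `c`. -/
lemma measure_stopSet_le (hp : ∀ i, 2 ≤ p i) {M : ℕ} (hM : ∀ i, p i ≤ M) :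
    volume (stopSet p b c ∩ Set.Ico 0 1)
      ≤ M * volume {x ∈ Set.Icc (0 : ℝ) 1 | ∃ n, c < ‖pricePartialSum p b n x‖} := by
  set V : ℕ → Set ℝ := fun i => {x | BoundedNear p b c i x ∧ ¬ BoundedNear p b c (i + 1) x}
  set W : ℕ → Set ℝ := fun i => {x | x ∈ V i ∧ c < ‖pricePartialSum p b (i + 1) x‖}
  have hV : ∀ i, CellConst p i (fun x => x ∈ V i) := fun i x y h =>
    propext (and_congr (boundedNear_congr hp i.le_succ h)
      (not_congr (boundedNear_congr hp le_rfl h)))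
  have hW : ∀ i, CellConst p (i + 1) (fun x => x ∈ W i) := fun i x y h => by
    have h1 : (x ∈ V i) = (y ∈ V i) := hV i x y (h.mono hp i.le_succ)
    have h2 := cellConst_pricePartialSum hp b (i + 1) x y h
    change (x ∈ V i ∧ _) = (y ∈ V i ∧ _)
    rw [h1, h2]
  have hsub : stopSet p b c ⊆ ⋃ i, V i := by
    rintro x ⟨n, hn⟩
    rw [Set.mem_iUnion]
    by_contra! H
    refine hn ?_
    clear hn
    induction n with
    | zero => exact fun i hi => absurd hi (Nat.not_lt_zero i)
    | succ n ih => exact not_not.1 fun h => H n ⟨ih, h⟩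
  have hVW : ∀ i, ∀ x ∈ V i, ∃ y ∈ W i, SameCell p i x y := by
    rintro i x ⟨hx1, hx2⟩
    simp only [BoundedNear, not_forall, not_le] at hx2
    obtain ⟨j, hj, y, hxy, hy⟩ := hx2
    have hji : j = i := by
      by_contra hne
      exact (hx1 j (by omega) y hxy).not_gt hy
    subst hji
    have hVy : (x ∈ V j) = (y ∈ V j) := hV j x y hxy
    refine ⟨y, ⟨hVy ▸ ⟨hx1, fun H => (H j hj y hxy).not_gt hy⟩, hy⟩, hxy⟩
  have hdisj : Pairwise (Function.onFun Disjoint fun i => W i ∩ Set.Ico (0 : ℝ) 1) := by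
    refine (pairwise_disjoint_on _).2 fun i j hij => Set.disjoint_left.2 ?_
    rintro x ⟨⟨⟨-, hx⟩, -⟩, -⟩ ⟨⟨⟨hx', -⟩, -⟩, -⟩
    exact hx (hx'.mono hij)
  calc volume (stopSet p b c ∩ Set.Ico 0 1)
      ≤ volume (⋃ i, V i ∩ Set.Ico (0 : ℝ) 1) := by
        rw [← Set.iUnion_inter]
        gcongr
    _ ≤ ∑' i, volume (V i ∩ Set.Ico (0 : ℝ) 1) := measure_iUnion_le _
    _ ≤ ∑' i, M * volume (W i ∩ Set.Ico (0 : ℝ) 1) := by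
        refine ENNReal.tsum_le_tsum fun i => ?_
        refine (measure_le_mul_of_cells hp (hV i) (hW i) (hVW i)).trans ?_
        gcongr
        exact hM i
    _ = M * volume (⋃ i, W i ∩ Set.Ico (0 : ℝ) 1) := by
        rw [ENNReal.tsum_mul_left, measure_iUnion hdisj fun i =>
          (measurableSet_of_cellConst hp (hW i)).inter measurableSet_Ico]
    _ ≤ _ := by
        gcongr
        refine Set.iUnion_subset fun i x hx => ⟨Set.Ico_subset_Icc_self hx.2, i + 1, hx.1.2⟩

open Classical in
/-- The pointwise limit of the stopped partial sums, `f` being the limit of the partial sums. -/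
def stoppedLimit (p : ℕ → ℕ) (b : ℕ → ℂ) (c : ℝ) (f : ℝ → ℂ) (x : ℝ) : ℂ :=
  if h : ∃ n, ¬ BoundedNear p b c n x then stoppedSum p b c (Nat.find h) x else f x

lemma tendsto_stoppedLimit {f : ℝ → ℂ} {x : ℝ}
    (hf : Tendsto (fun n => pricePartialSum p b n x) atTop (𝓝 (f x))) :
    Tendsto (fun n => stoppedSum p b c n x) atTop (𝓝 (stoppedLimit p b c f x)) := by
  classical
  unfold stoppedLimit
  split_ifs with h
  · refine tendsto_const_nhds.congr' ?_
    filter_upwards [eventually_ge_atTop (Nat.find h)] with n hn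
    exact (stoppedSum_eq_of_le hn (Nat.find_spec h)).symm
  · refine hf.congr fun n => (stoppedSum_eq ?_).symm
    push Not at h
    exact h n

lemma measurable_clip (c : ℝ) : Measurable fun z : ℂ => if ‖z‖ ≤ c then z else 0 :=
  Measurable.ite (measurableSet_le measurable_norm measurable_const) measurable_id
    measurable_const

lemma norm_trunc_le {α : Type*} (g : α → ℂ) (hc : 0 ≤ c) (x : α) : ‖trunc g c x‖ ≤ c := by
  unfold trunc
  split_ifs with h
  · exact h
  · simpa using hc

lemma norm_integral_trunc_sub_le (hp : ∀ i, 2 ≤ p i) {M : ℕ} (hM : ∀ i, p i ≤ M)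
    {f : ℝ → ℂ} (hconv : ∀ᵐ x ∂(volume.restrict (Set.Ico (0 : ℝ) 1)),
      Tendsto (fun n => pricePartialSum p b n x) atTop (𝓝 (f x)))
    {N k : ℕ} (hk : k < mseq p N) (hc : ∑ j ∈ Finset.range (mseq p N), ‖b j‖ ≤ c) :
    ‖(∫ x in Set.Ico (0 : ℝ) 1,
        trunc (fun y => f y * (starRingEnd ℂ) (price p k y)) c x) - b k‖
      ≤ 2 * M * (c * (volume {x ∈ Set.Icc (0 : ℝ) 1 |
          ∃ n, c < ‖pricePartialSum p b n x‖}).toReal) := by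
  have hc0 : 0 ≤ c := (Finset.sum_nonneg fun _ _ => norm_nonneg _).trans hc
  have hsmall : ∀ n ≤ N, ∀ x, ‖pricePartialSum p b n x‖ ≤ c := fun n hn x =>
    (norm_pricePartialSum_le p b n x).trans <| le_trans (Finset.sum_le_sum_of_subset_of_nonneg
      (Finset.range_mono (mseq_mono hp hn)) fun _ _ _ => norm_nonneg _) hc
  have hN : ∀ x, BoundedNear p b c N x := fun x i hi y _ => hsmall (i + 1) hi y
  have hT := norm_stoppedSum_le (hsmall 0 (Nat.zero_le _))
  set L := stoppedLimit p b c f with hL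
  have hlim : ∀ᵐ x ∂(volume.restrict (Set.Ico (0 : ℝ) 1)),
      Tendsto (fun n => stoppedSum p b c n x) atTop (𝓝 (L x)) :=
    hconv.mono fun x hx => tendsto_stoppedLimit hx
  have hLnorm : ∀ᵐ x ∂(volume.restrict (Set.Ico (0 : ℝ) 1)), ‖L x‖ ≤ c :=
    hlim.mono fun x hx => le_of_tendsto' hx.norm fun n => hT n x
  have mprice : Measurable fun x => (starRingEnd ℂ) (price p k x) :=
    (Complex.continuous_conj.measurable).comp ((cellConst_price hp hk).measurable hp)
  have mT : ∀ n, Measurable (stoppedSum p b c n) := fun n =>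
    (cellConst_stoppedSum hp n).measurable hp
  have mL : AEMeasurable L (volume.restrict (Set.Ico (0 : ℝ) 1)) :=
    aemeasurable_of_tendsto_metrizable_ae atTop (fun n => (mT n).aemeasurable) hlim
  have mf : AEMeasurable f (volume.restrict (Set.Ico (0 : ℝ) 1)) :=
    aemeasurable_of_tendsto_metrizable_ae atTop
      (fun n => ((cellConst_pricePartialSum hp b n).measurable hp).aemeasurable) hconv
  have hnorm_conj : ∀ x, ‖(starRingEnd ℂ) (price p k x)‖ = 1 := fun x => by
    rw [RCLike.norm_conj, norm_price]
  have hint : ∫ x in Set.Ico (0 : ℝ) 1, L x * (starRingEnd ℂ) (price p k x) = b k := by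
    refine tendsto_nhds_unique (tendsto_integral_of_dominated_convergence (fun _ => c)
      (F := fun n x => stoppedSum p b c n x * (starRingEnd ℂ) (price p k x))
      (fun n => ((mT n).mul mprice).aestronglyMeasurable) (integrable_const c)
      (fun n => ae_of_all _ fun x => ?_) (hlim.mono fun x hx => hx.mul_const _)) ?_
    · rw [norm_mul, hnorm_conj, mul_one]
      exact hT n x
    · refine tendsto_const_nhds.congr' ?_
      filter_upwards [eventually_ge_atTop N] with n hn
      exact (integral_stoppedSum_mul_conj hp hk hN hn).symm
  have iL : IntegrableOn (fun x => L x * (starRingEnd ℂ) (price p k x))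
      (Set.Ico (0 : ℝ) 1) := by
    refine Integrable.mono' (integrable_const c)
      (mL.mul mprice.aemeasurable).aestronglyMeasurable (hLnorm.mono fun x hx => ?_)
    rwa [norm_mul, hnorm_conj, mul_one]
  have iF : IntegrableOn (trunc (fun y => f y * (starRingEnd ℂ) (price p k y)) c)
      (Set.Ico (0 : ℝ) 1) := by
    refine Integrable.mono' (integrable_const c) ?_ (ae_of_all _ (norm_trunc_le _ hc0))
    exact ((measurable_clip c).comp_aemeasurable
      (mf.mul mprice.aemeasurable)).aestronglyMeasurable
  have hbound : ∀ᵐ x ∂(volume.restrict (Set.Ico (0 : ℝ) 1)),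
      ‖trunc (fun y => f y * (starRingEnd ℂ) (price p k y)) c x
        - L x * (starRingEnd ℂ) (price p k x)‖
      ≤ (stopSet p b c).indicator (fun _ => 2 * c) x := by
    filter_upwards [hLnorm] with x hx
    by_cases hxV : x ∈ stopSet p b c
    · rw [Set.indicator_of_mem hxV, two_mul]
      refine (norm_sub_le _ _).trans (add_le_add (norm_trunc_le _ hc0 x) ?_)
      rwa [norm_mul, hnorm_conj, mul_one]
    · have hLf : L x = f x := dif_neg hxV
      rw [Set.indicator_of_notMem hxV, trunc, if_pos, hLf, sub_self, norm_zero]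
      rwa [norm_mul, hnorm_conj, mul_one, ← hLf]
  have mV := measurableSet_stopSet (b := b) (c := c) hp
  rw [← hint, ← integral_sub iF iL]
  refine (norm_integral_le_of_norm_le ((integrable_const (2 * c)).indicator mV) hbound).trans ?_
  rw [integral_indicator_const _ mV, measureReal_restrict_apply mV, smul_eq_mul]
  have hE : volume {x ∈ Set.Icc (0 : ℝ) 1 | ∃ n, c < ‖pricePartialSum p b n x‖} ≠ ⊤ :=
    measure_ne_top_of_subset (Set.sep_subset _ _) (by simp)
  have hVE := ENNReal.toReal_mono (ENNReal.mul_ne_top (by simp) hE)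
    (measure_stopSet_le (b := b) (c := c) hp hM)
  rw [ENNReal.toReal_mul, ENNReal.toReal_natCast] at hVE
  calc volume.real (stopSet p b c ∩ Set.Ico 0 1) * (2 * c)
      ≤ (M * (volume {x ∈ Set.Icc (0 : ℝ) 1 |
          ∃ n, c < ‖pricePartialSum p b n x‖}).toReal) * (2 * c) := by
        gcongr
        exact hVE
    _ = _ := by ring

end Stopping

/-- **Theorem (Kostin).**  Let `P = {pᵢ}` with `sup pᵢ ≤ M < ∞` and suppose the partial
sums `S_{m_n} = ∑_{k < m_n} b_k ψ_k` of a Price series converge a.e. on `[0,1]` to `f`.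
If there is a sequence `λ_m ↑ ∞` with `λ_m · μ{x ∈ [0,1] : S*(x) > λ_m} → 0`, where
`S*(x) = sup_n |S_{m_n}(x)|`, then for every `k`,
`b_k = lim_m ∫_0^1 [f · conj ψ_k]_{λ_m}`. -/
theorem coefficient_recovery_price_one_dim
    (p : ℕ → ℕ) (hp : ∀ i, 2 ≤ p i) (M : ℕ) (hM : ∀ i, p i ≤ M)
    (b : ℕ → ℂ) (f : ℝ → ℂ)
    (hconv : ∀ᵐ x ∂(volume.restrict (Set.Icc (0 : ℝ) 1)),
      Tendsto (fun n => ∑ k ∈ Finset.range (mseq p n), b k * price p k x)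
        atTop (𝓝 (f x)))
    (lam : ℕ → ℝ) (hmono : Monotone lam) (htop : Tendsto lam atTop atTop)
    (hsmall : Tendsto (fun m => lam m *
        (volume {x ∈ Set.Icc (0 : ℝ) 1 |
          ∃ n, lam m < ‖∑ k ∈ Finset.range (mseq p n), b k * price p k x‖}).toReal)
      atTop (𝓝 0)) :
    ∀ k : ℕ,
      Tendsto (fun m => ∫ x in Set.Icc (0 : ℝ) 1,
          trunc (fun y => f y * (starRingEnd ℂ) (price p k y)) (lam m) x)
        atTop (𝓝 (b k)) := by
  intro k
  rw [tendsto_iff_norm_sub_tendsto_zero]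
  refine squeeze_zero' (Eventually.of_forall fun _ => norm_nonneg _) ?_
    (by simpa using hsmall.const_mul (2 * M : ℝ))
  filter_upwards [htop.eventually_ge_atTop
    (∑ j ∈ Finset.range (mseq p (k + 1)), ‖b j‖)] with m hm
  rw [integral_Icc_eq_integral_Ico]
  exact norm_integral_trunc_sub_le hp hM
    (ae_restrict_of_ae_restrict_of_subset Set.Ico_subset_Icc_self hconv)
    (k.lt_succ_self.trans (lt_mseq hp _)) hm
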